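/- arXiv:1411.0756 — 2 statements merged into one kernel-verified Lean document; each statement's English description precedes it below -/
import Mathlib

section
/- Let (P, Act_τ, →, F) be an LLTS. Then for all p, q ∈ P: p ⊑RS q if and only if p ⊑ALT q. -/
/-- A labelled transition system with inconsistency predicate `F`.
Labels are `Option Act`: `some a` is a visible action `a ∈ Act`, `none` is `τ`. -/
structure LTS (P : Type*) (Act : Type*) where
  Trans : P → Option Act → P → Prop
  F : Set P

namespace LTS

variable {P Act : Type*}

/-- A state is stable if it has no `τ`-transition. -/
def stable (L : LTS P Act) (p : P) : Prop := ¬ ∃ q, L.Trans p none q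

/-- The ready set `I(p)` of a state. -/
def ready (L : LTS P Act) (p : P) : Set (Option Act) := {α | ∃ q, L.Trans p α q}

/-- `p ⇒ε_F q`: a (possibly empty) sequence of `τ`-transitions from `p` to `q`
all of whose states (including `p` and `q`) are not in `F`. -/
inductive EpsF (L : LTS P Act) : P → P → Prop
  | refl {p : P} : p ∉ L.F → EpsF L p p
  | step {p q r : P} : p ∉ L.F → L.Trans p none q → EpsF L q r → EpsF L p r

/-- `p ⇒a_F q` for a visible action `a`. -/
def ActF (L : LTS P Act) (a : Act) (p q : P) : Prop :=
  ∃ r s, L.EpsF p r ∧ L.Trans r (some a) s ∧ L.EpsF s q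

/-- `p ⇒ε_F| q`. -/
def EpsFStable (L : LTS P Act) (p q : P) : Prop := L.EpsF p q ∧ L.stable q

/-- `p ⇒a_F| q`. -/
def ActFStable (L : LTS P Act) (a : Act) (p q : P) : Prop := L.ActF a p q ∧ L.stable q

/-- Logic LTS: conditions (LTS1) and (LTS2). -/
def IsLLTS (L : LTS P Act) : Prop :=
  (∀ p α, (∃ q, L.Trans p α q) → (∀ q, L.Trans p α q → q ∈ L.F) → p ∈ L.F) ∧
  (∀ p, (¬ ∃ q, L.EpsFStable p q) → p ∈ L.F)

/-- `R` is a stable ready simulation relation: conditions (RS1)-(RS4). -/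
def IsStableRS (L : LTS P Act) (R : P → P → Prop) : Prop :=
  ∀ p q, R p q →
    (L.stable p ∧ L.stable q) ∧
    (p ∉ L.F → q ∉ L.F) ∧
    (∀ (a : Act) (p' : P), L.ActFStable a p p' → ∃ q', L.ActFStable a q q' ∧ R p' q') ∧
    (p ∉ L.F → L.ready p = L.ready q)

/-- `p ⊏~RS q`. -/
def SRS (L : LTS P Act) (p q : P) : Prop := ∃ R, L.IsStableRS R ∧ R p q

/-- `p ⊑RS q`. -/
def RSLe (L : LTS P Act) (p q : P) : Prop :=
  ∀ p', L.EpsFStable p p' → ∃ q', L.EpsFStable q q' ∧ L.SRS p' q'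

end LTS

/-- `R` is an alternative ready simulation relation: conditions (RSi), (RSiii), (RSiv). -/
def LTS.IsAltRS {P Act : Type*} (L : LTS P Act) (R : P → P → Prop) : Prop :=
  ∀ p q, R p q →
    (∀ p', L.EpsFStable p p' → ∃ q', L.EpsFStable q q' ∧ R p' q') ∧
    (∀ (a : Act) (p' : P), L.stable p → L.stable q →
      L.ActFStable a p p' → ∃ q', L.ActFStable a q q' ∧ R p' q') ∧
    (L.stable p → L.stable q → p ∉ L.F → L.ready p = L.ready q)

/-- `p ⊑ALT q`. -/
def LTS.AltLe {P Act : Type*} (L : LTS P Act) (p q : P) : Prop :=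
  ∃ R, L.IsAltRS R ∧ R p q

namespace LTS

theorem EpsF.left_notMem {P Act : Type*} {L : LTS P Act} {p q : P} (h : L.EpsF p q) :
    p ∉ L.F := by
  cases h <;> assumption

theorem EpsF.right_notMem {P Act : Type*} {L : LTS P Act} {p q : P} (h : L.EpsF p q) :
    q ∉ L.F := by
  induction h with
  | refl h => exact h
  | step _ _ _ ih => exact ih

theorem EpsF.eq_of_stable {P Act : Type*} {L : LTS P Act} {p q : P} (h : L.EpsF p q)
    (hp : L.stable p) : p = q := by
  cases h with
  | refl => rfl
  | step _ ht _ => exact absurd ⟨_, ht⟩ hp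

theorem ActF.left_notMem {P Act : Type*} {L : LTS P Act} {a : Act} {p q : P}
    (h : L.ActF a p q) : p ∉ L.F := by
  obtain ⟨_, _, h, _, _⟩ := h
  exact h.left_notMem

theorem SRS.rsLe {P Act : Type*} {L : LTS P Act} {p q : P} (h : L.SRS p q) : L.RSLe p q := by
  obtain ⟨R, hR, hpq⟩ := h
  obtain ⟨⟨hp, hq⟩, hF, -, -⟩ := hR p q hpq
  rintro p' ⟨hpp', -⟩
  obtain rfl := hpp'.eq_of_stable hp
  exact ⟨q, ⟨.refl (hF hpp'.left_notMem), hq⟩, R, hR, hpq⟩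

/-- On stable states, `⊑RS` gives `⊏~RS` as soon as the left state is consistent. -/
theorem RSLe.srs {P Act : Type*} {L : LTS P Act} {p q : P} (h : L.RSLe p q)
    (hp : L.stable p) (hq : L.stable q) (hpF : p ∉ L.F) : L.SRS p q := by
  obtain ⟨q', ⟨hqq', -⟩, hs⟩ := h p ⟨.refl hpF, hp⟩
  obtain rfl := hqq'.eq_of_stable hq
  exact hs

theorem isAltRS_rsLe {P Act : Type*} (L : LTS P Act) : L.IsAltRS L.RSLe := by
  intro p q h
  refine ⟨fun p' hp' => ?_, fun a p' hp hq hpp' => ?_, fun hp hq hpF => ?_⟩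
  · obtain ⟨q', hq', hs⟩ := h p' hp'
    exact ⟨q', hq', hs.rsLe⟩
  · obtain ⟨R, hR, hpq⟩ := h.srs hp hq hpp'.1.left_notMem
    obtain ⟨q', hqq', hR'⟩ := (hR p q hpq).2.2.1 a p' hpp'
    exact ⟨q', hqq', SRS.rsLe ⟨R, hR, hR'⟩⟩
  · obtain ⟨R, hR, hpq⟩ := h.srs hp hq hpF
    exact (hR p q hpq).2.2.2 hpF

/-- The restriction of an alternative ready simulation relation to stable states is a stable
ready simulation relation. -/
theorem IsAltRS.isStableRS {P Act : Type*} {L : LTS P Act} {R : P → P → Prop}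
    (hR : L.IsAltRS R) :
    L.IsStableRS fun p q => R p q ∧ L.stable p ∧ L.stable q := by
  rintro p q ⟨hpq, hp, hq⟩
  obtain ⟨hε, ha, hI⟩ := hR p q hpq
  refine ⟨⟨hp, hq⟩, fun hpF => ?_, fun a p' hpp' => ?_, hI hp hq⟩
  · obtain ⟨q', hqq', -⟩ := hε p ⟨.refl hpF, hp⟩
    exact hqq'.1.left_notMem
  · obtain ⟨q', hqq', hR'⟩ := ha a p' hp hq hpp'
    exact ⟨q', hqq', hR', hpp'.2, hqq'.2⟩

end LTS

/-- In an LLTS, `⊑RS` and `⊑ALT` coincide. -/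
theorem rsLe_iff_altLe {P Act : Type*} (L : LTS P Act) (hL : L.IsLLTS) :
    ∀ p q : P, L.RSLe p q ↔ L.AltLe p q := by
  refine fun p q => ⟨fun h => ⟨L.RSLe, L.isAltRS_rsLe, h⟩, ?_⟩
  rintro ⟨R, hR, hpq⟩ p' hp'
  obtain ⟨q', hq', hR'⟩ := (hR p q hpq).1 p' hp'
  exact ⟨q', hq', _, hR.isStableRS, hR', hp'.2, hq'.2⟩
end

section
/- Let (P, Act_τ, →, F) be an LLTS. If R ⊆ P × P is an alternative ready simulation relation up to ⊏~RS, then R ⊆ ⊑RS, i.e., (p,q) ∈ R implies p ⊑RS q. -/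
/-- `R` is an alternative ready simulation relation up to `⊏~RS`. -/
def LTS.IsAltRSUpto {P Act : Type*} (L : LTS P Act) (R : P → P → Prop) : Prop :=
  ∀ p q, R p q →
    (∀ p', L.EpsFStable p p' → ∃ q', L.EpsFStable q q' ∧
      ∃ u v, L.SRS p' u ∧ R u v ∧ L.SRS v q') ∧
    (∀ (a : Act) (p' : P), L.stable p → L.stable q →
      L.ActFStable a p p' → ∃ q', L.ActFStable a q q' ∧
        ∃ u v, L.SRS p' u ∧ R u v ∧ L.SRS v q') ∧
    (L.stable p → L.stable q → p ∉ L.F → L.ready p = L.ready q)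

namespace LTS

variable {P Act : Type*} {L : LTS P Act}

theorem EpsF.source_notMem {p q : P} (h : L.EpsF p q) : p ∉ L.F := by
  cases h <;> assumption

/-- `⊏~RS` is itself a stable ready simulation relation. -/
theorem isStableRS_SRS (L : LTS P Act) : L.IsStableRS L.SRS := by
  rintro p q ⟨R, hR, hpq⟩
  obtain ⟨hst, hF, hact, hready⟩ := hR p q hpq
  refine ⟨hst, hF, fun a p' hp' => ?_, hready⟩
  obtain ⟨q', hq', hR'⟩ := hact a p' hp'
  exact ⟨q', hq', R, hR, hR'⟩

theorem IsStableRS.comp {R S : P → P → Prop} (hR : L.IsStableRS R) (hS : L.IsStableRS S) :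
    L.IsStableRS (Relation.Comp R S) := by
  rintro p r ⟨q, hpq, hqr⟩
  obtain ⟨⟨hp, -⟩, hF₁, hact₁, hready₁⟩ := hR p q hpq
  obtain ⟨⟨-, hr⟩, hF₂, hact₂, hready₂⟩ := hS q r hqr
  refine ⟨⟨hp, hr⟩, fun h => hF₂ (hF₁ h), fun a p' hp' => ?_,
    fun h => (hready₁ h).trans (hready₂ (hF₁ h))⟩
  obtain ⟨q', hq', hpq'⟩ := hact₁ a p' hp'
  obtain ⟨r', hr', hqr'⟩ := hact₂ a q' hq'
  exact ⟨r', hr', q', hpq', hqr'⟩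

theorem SRS.trans {p q r : P} (hpq : L.SRS p q) (hqr : L.SRS q r) : L.SRS p r :=
  ⟨_, L.isStableRS_SRS.comp L.isStableRS_SRS, q, hpq, hqr⟩

/-- The closure `⊏~RS ∘ R ∘ ⊏~RS` of an alternative ready simulation relation `R` up to `⊏~RS`
is a stable ready simulation relation. -/
theorem IsAltRSUpto.isStableRS {R : P → P → Prop} (hR : L.IsAltRSUpto R) :
    L.IsStableRS fun p q => ∃ u v, L.SRS p u ∧ R u v ∧ L.SRS v q := by
  rintro p q ⟨u, v, hpu, huv, hvq⟩
  obtain ⟨⟨hp, hu⟩, hF₁, hact₁, hready₁⟩ := L.isStableRS_SRS p u hpu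
  obtain ⟨⟨hv, hq⟩, hF₂, hact₂, hready₂⟩ := L.isStableRS_SRS v q hvq
  obtain ⟨heps, hact, hready⟩ := hR u v huv
  have hF : u ∉ L.F → v ∉ L.F := fun h => by
    obtain ⟨v', hv', -⟩ := heps u ⟨.refl h, hu⟩
    exact hv'.1.source_notMem
  refine ⟨⟨hp, hq⟩, fun h => hF₂ (hF (hF₁ h)), fun a p' hp' => ?_, fun h =>
    (hready₁ h).trans ((hready hu hv (hF₁ h)).trans (hready₂ (hF (hF₁ h))))⟩
  obtain ⟨u', hu', hpu'⟩ := hact₁ a p' hp'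
  obtain ⟨v', hv', x, y, hux, hxy, hyv⟩ := hact a u' hu hv hu'
  obtain ⟨q', hq', hvq'⟩ := hact₂ a v' hv'
  exact ⟨q', hq', x, y, hpu'.trans hux, hxy, hyv.trans hvq'⟩

end LTS

/-- Any alternative ready simulation relation up to `⊏~RS`
is contained in `⊑RS`. -/
theorem altUpto_subset_rsLe {P Act : Type*} (L : LTS P Act) (hL : L.IsLLTS)
    (R : P → P → Prop) (hR : L.IsAltRSUpto R) :
    ∀ p q : P, R p q → L.RSLe p q := by
  intro p q hpq p' hp'
  obtain ⟨q', hq', h⟩ := (hR p q hpq).1 p' hp'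
  exact ⟨q', hq', _, hR.isStableRS, h⟩
end
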